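/- arXiv:2406.11220 — 4 statements merged into one kernel-verified Lean document; each statement's English description precedes it below -/
import Mathlib

section
/- Let N be a positive integer, let α̃₁, …, α̃_N be positive real numbers, and let N_RF be a positive real number. Define s*_n = (N_RF/α̃_n) / (∑_{m=1}^{N} 1/α̃_m) for n = 1, …, N. Then s*_n > 0 for all n, ∑_{n=1}^{N} s*_n = N_RF, min_{1≤n≤N} α̃_n s*_n = N_RF / (∑_{m=1}^{N} 1/α̃_m), and for every tuple (s₁, …, s_N) of positive real numbers with ∑_{n=1}^{N} s_n = N_RF one has min_{1≤n≤N} α̃_n s_n ≤ N_RF / (∑_{m=1}^{N} 1/α̃_m). In other words, s* is the solution of the continuous-relaxed max-min subarray allocation problem max_{s_n>0, ∑ s_n = N_RF} min_n α̃_n s_n. -/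
open Finset

theorem fair_subarray_allocation_closed_form
    (N : ℕ) (hN : 0 < N) (α : Fin N → ℝ) (hα : ∀ n, 0 < α n)
    (NRF : ℝ) (hNRF : 0 < NRF)
    (s : Fin N → ℝ)
    (hs : ∀ n, s n = (NRF / α n) / (∑ m, 1 / α m)) :
    (∀ n, 0 < s n) ∧
    (∑ n, s n = NRF) ∧
    (Finset.univ.inf' (Finset.univ_nonempty_iff.mpr (Fin.pos_iff_nonempty.mp hN))
        (fun n => α n * s n) = NRF / (∑ m, 1 / α m)) ∧
    (∀ t : Fin N → ℝ, (∀ n, 0 < t n) → (∑ n, t n = NRF) →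
      Finset.univ.inf' (Finset.univ_nonempty_iff.mpr (Fin.pos_iff_nonempty.mp hN))
        (fun n => α n * t n) ≤ NRF / (∑ m, 1 / α m)) := by
  have hne : (univ : Finset (Fin N)).Nonempty :=
    Finset.univ_nonempty_iff.mpr (Fin.pos_iff_nonempty.mp hN)
  have hsum : 0 < ∑ m, 1 / α m :=
    Finset.sum_pos (fun m _ => one_div_pos.mpr (hα m)) hne
  have hval : ∀ n, α n * s n = NRF / ∑ m, 1 / α m := fun n => by
    rw [hs, ← mul_div_assoc, mul_div_cancel₀ _ (hα n).ne']
  refine ⟨fun n => ?_, ?_, ?_, fun t _ ht => ?_⟩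
  · rw [hs]
    exact div_pos (div_pos hNRF (hα n)) hsum
  · simp_rw [hs, ← Finset.sum_div, div_eq_mul_one_div NRF (α _), ← Finset.mul_sum]
    exact mul_div_cancel_right₀ NRF hsum.ne'
  · simp_rw [hval]
    exact Finset.inf'_const hne _
  · rw [le_div_iff₀ hsum, Finset.mul_sum, ← ht]
    refine Finset.sum_le_sum fun n hn => ?_
    rw [mul_one_div, div_le_iff₀' (hα n)]
    exact Finset.inf'_le (fun n => α n * t n) hn
end

section
/- Let N be a positive integer and let α₁, …, α_N and s₁, …, s_N be positive real numbers. Then min_{1≤n≤N} α_n s_n = (∑_{n=1}^{N} s_n) / (∑_{n=1}^{N} 1/α_n) holds if and only if s_n = (1/α_n) · (∑_{m=1}^{N} s_m) / (∑_{m=1}^{N} 1/α_m) for every n = 1, …, N. -/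
open Finset

theorem min_weighted_eq_iff_proportional
    (N : ℕ) (hN : 0 < N) (α s : Fin N → ℝ)
    (hα : ∀ n, 0 < α n) (hs : ∀ n, 0 < s n) :
    Finset.univ.inf' (Finset.univ_nonempty_iff.mpr (Fin.pos_iff_nonempty.mp hN))
        (fun n => α n * s n) = (∑ n, s n) / (∑ n, 1 / α n)
      ↔ ∀ n, s n = (1 / α n) * ((∑ m, s m) / (∑ m, 1 / α m)) := by
  have hne : (Finset.univ : Finset (Fin N)).Nonempty :=
    Finset.univ_nonempty_iff.mpr (Fin.pos_iff_nonempty.mp hN)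
  have hA : 0 < ∑ m, 1 / α m := Finset.sum_pos (fun n _ => one_div_pos.mpr (hα n)) hne
  set c := (∑ m, s m) / (∑ m, 1 / α m) with hc
  constructor
  · intro h
    have hle : ∀ n ∈ Finset.univ, 1 / α n * c ≤ s n := fun n hn => by
      have hcn : c ≤ α n * s n := h ▸ Finset.inf'_le (fun n => α n * s n) hn
      rwa [one_div_mul_eq_div, div_le_iff₀' (hα n)]
    have hsum : ∑ n, 1 / α n * c = ∑ n, s n := by
      rw [← Finset.sum_mul, hc, mul_div_cancel₀ _ hA.ne']
    exact fun n => ((Finset.sum_eq_sum_iff_of_le hle).mp hsum n (Finset.mem_univ n)).symm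
  · intro h
    have hconst : (fun n => α n * s n) = fun _ => c := funext fun n => by
      rw [h n, ← mul_assoc, mul_one_div_cancel (hα n).ne', one_mul]
    simp only [hconst, Finset.inf'_const]
end

section
/- Let K and P be positive integers, let B and f_c be real numbers with f_c ≠ 0, define ξ_k = 1 + (B/f_c)·((k − 1 − (K−1)/2)/K) for k = 1, …, K and Γ = 1 + B²(K² − 1)/(12 f_c² K²), and let x₁, …, x_P and γ₁, …, γ_P be real numbers. Define J(t) = ∑_{k=1}^{K} ∑_{p=1}^{P} (−2 f_c ξ_k t + x_p + ξ_k γ_p)² for t ∈ ℝ. Then t* = (1/(2 f_c P))·((1/Γ)·∑_{p=1}^{P} x_p + ∑_{p=1}^{P} γ_p) satisfies J(t*) ≤ J(t) for every t ∈ ℝ. -/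
theorem sum_fin_cast (K : ℕ) : ∑ k : Fin K, (k : ℝ) = (K : ℝ) * (K - 1) / 2 := by
  induction K with
  | zero => simp
  | succ n ih =>
    rw [Fin.sum_univ_castSucc]
    simp only [Fin.val_castSucc, Fin.val_last, ih]
    push_cast
    ring

theorem sum_fin_cast_sq (K : ℕ) :
    ∑ k : Fin K, (k : ℝ) ^ 2 = (K : ℝ) * (K - 1) * (2 * K - 1) / 6 := by
  induction K with
  | zero => simp
  | succ n ih =>
    rw [Fin.sum_univ_castSucc]
    simp only [Fin.val_castSucc, Fin.val_last, ih]
    push_cast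
    ring

/-- The subcarrier offsets are centred. -/
theorem sum_one_add_mul_centered {K : ℕ} (hK : 0 < K) (b : ℝ) :
    ∑ k : Fin K, (1 + b * (((k : ℝ) - ((K : ℝ) - 1) / 2) / K)) = K := by
  have hK' : (K : ℝ) ≠ 0 := by positivity
  have h : ∀ k : Fin K, 1 + b * (((k : ℝ) - ((K : ℝ) - 1) / 2) / K) =
      (1 - b * (((K : ℝ) - 1) / 2) / K) + b / K * (k : ℝ) := fun k => by ring
  simp only [h, Finset.sum_add_distrib, ← Finset.mul_sum, sum_fin_cast, Finset.sum_const,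
    Finset.card_univ, Fintype.card_fin, nsmul_eq_mul]
  field_simp
  ring

theorem sum_one_add_mul_centered_sq {K : ℕ} (hK : 0 < K) (b : ℝ) :
    ∑ k : Fin K, (1 + b * (((k : ℝ) - ((K : ℝ) - 1) / 2) / K)) ^ 2 =
      (1 + b ^ 2 * ((K : ℝ) ^ 2 - 1) / (12 * (K : ℝ) ^ 2)) * K := by
  have hK' : (K : ℝ) ≠ 0 := by positivity
  have h : ∀ k : Fin K, (1 + b * (((k : ℝ) - ((K : ℝ) - 1) / 2) / K)) ^ 2 =
      (1 - b * (((K : ℝ) - 1) / 2) / K) ^ 2 +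
        2 * (1 - b * (((K : ℝ) - 1) / 2) / K) * (b / K) * (k : ℝ) +
        (b / K) ^ 2 * (k : ℝ) ^ 2 := fun k => by ring
  simp only [h, Finset.sum_add_distrib, ← Finset.mul_sum, sum_fin_cast, sum_fin_cast_sq,
    Finset.sum_const, Finset.card_univ, Fintype.card_fin, nsmul_eq_mul]
  field_simp
  ring

/-- The double sum of squares, expanded as a quadratic polynomial in `t`. -/
theorem sum_sum_sq_eq_quadratic {ι κ : Type*} [Fintype ι] [Fintype κ] (c t : ℝ) (ξ : ι → ℝ)
    (x γ : κ → ℝ) :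
    ∑ k, ∑ p, (-2 * c * ξ k * t + x p + ξ k * γ p) ^ 2 =
      4 * c ^ 2 * (∑ k, ξ k ^ 2) * Fintype.card κ * t ^ 2 -
        4 * c * t * ((∑ k, ξ k) * ∑ p, x p + (∑ k, ξ k ^ 2) * ∑ p, γ p) +
        ∑ k, ∑ p, (x p + ξ k * γ p) ^ 2 := by
  have h : ∀ k, ∑ p, (-2 * c * ξ k * t + x p + ξ k * γ p) ^ 2 =
      4 * c ^ 2 * Fintype.card κ * t ^ 2 * ξ k ^ 2 - 4 * c * t * (∑ p, x p) * ξ k -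
        4 * c * t * (∑ p, γ p) * ξ k ^ 2 + ∑ p, (x p + ξ k * γ p) ^ 2 := fun k => by
    have h' : ∀ p, (-2 * c * ξ k * t + x p + ξ k * γ p) ^ 2 =
        4 * c ^ 2 * t ^ 2 * ξ k ^ 2 - 4 * c * t * ξ k * x p - 4 * c * t * ξ k ^ 2 * γ p +
          (x p + ξ k * γ p) ^ 2 := fun p => by ring
    rw [Finset.sum_congr rfl fun p _ => h' p]
    rw [Finset.sum_add_distrib, Finset.sum_sub_distrib, Finset.sum_sub_distrib,
      ← Finset.mul_sum, ← Finset.mul_sum, Finset.sum_const, Finset.card_univ, nsmul_eq_mul,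
      ← Finset.mul_sum]
    ring
  rw [Finset.sum_congr rfl fun k _ => h k]
  rw [Finset.sum_add_distrib, Finset.sum_sub_distrib, Finset.sum_sub_distrib,
    ← Finset.mul_sum, ← Finset.mul_sum, ← Finset.mul_sum]
  ring

theorem ttd_value_closed_form_minimizer
    (K P : ℕ) (hK : 0 < K) (hP : 0 < P) (B fc : ℝ) (hfc : fc ≠ 0)
    (ξ : Fin K → ℝ)
    (hξ : ∀ k : Fin K, ξ k = 1 + (B / fc) * (((k : ℝ) - ((K : ℝ) - 1) / 2) / K))
    (Γ : ℝ)
    (hΓ : Γ = 1 + B ^ 2 * ((K : ℝ) ^ 2 - 1) / (12 * fc ^ 2 * (K : ℝ) ^ 2))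
    (x γ : Fin P → ℝ)
    (J : ℝ → ℝ)
    (hJ : ∀ t : ℝ, J t = ∑ k, ∑ p, (-2 * fc * ξ k * t + x p + ξ k * γ p) ^ 2)
    (tstar : ℝ)
    (htstar : tstar = (1 / (2 * fc * P)) * ((1 / Γ) * ∑ p, x p + ∑ p, γ p)) :
    ∀ t : ℝ, J tstar ≤ J t := by
  have hK' : (0 : ℝ) < K := by positivity
  have hP' : (0 : ℝ) < P := by positivity
  have hK1 : (1 : ℝ) ≤ K := by exact_mod_cast hK
  have hΓpos : 0 < Γ := by
    have : 0 ≤ (K : ℝ) ^ 2 - 1 := by nlinarith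
    rw [hΓ]
    positivity
  have hsum : ∑ k, ξ k = K := by
    simp only [hξ]
    exact sum_one_add_mul_centered hK _
  have hsum_sq : ∑ k, ξ k ^ 2 = Γ * K := by
    simp only [hξ]
    rw [sum_one_add_mul_centered_sq hK, hΓ]
    field_simp
  intro t
  have hroot : 2 * fc * P * Γ * tstar = ∑ p, x p + Γ * ∑ p, γ p := by
    rw [htstar]
    field_simp
  have hdiff : J t - J tstar = 4 * fc ^ 2 * Γ * K * P * (t - tstar) ^ 2 := by
    rw [hJ, hJ, sum_sum_sq_eq_quadratic, sum_sum_sq_eq_quadratic, hsum, hsum_sq,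
      Fintype.card_fin]
    linear_combination 4 * fc * K * (t - tstar) * hroot
  have hnonneg : 0 ≤ 4 * fc ^ 2 * Γ * K * P * (t - tstar) ^ 2 := by positivity
  linarith
end

section
/- Let K, N_t, N_r, N_RF, and N be positive integers with N ≥ 1, let ρ > 0 and ω ≥ 0 be real numbers, let τ ∈ ℝ, and fix an index n ∈ {1, …, N}. For each k = 1, …, K, let α_k ∈ ℂ, f_k ∈ ℝ, let u_k ∈ ℂ^{N_t}, let v_k ∈ ℂ^{N_r} with ‖v_k‖ = 1, let A_k ∈ ℂ^{N_t × N_RF} be a matrix, and let w_{k,1}, …, w_{k,N} ∈ ℂ^{N_RF} be vectors with ‖w_{k,m}‖² ≤ ω for all m. Define H_k = √(N_t N_r) · α_k · e^{−i 2π f_k τ} · v_k u_k^† ∈ ℂ^{N_r × N_t}. Then ∑_{k=1}^{K} log₂( 1 + ((ρ/N)‖H_k A_k w_{k,n}‖²) / (∑_{n′ ≠ n} (ρ/N)‖H_k A_k w_{k,n′}‖² + 1) ) ≤ (ρ ω N_r N_t / (N · ln 2)) · ∑_{k=1}^{K} |α_k|² · ‖A_k^† u_k‖². -/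
open Real Finset

theorem norm_sq_dotProduct_le {ι : Type*} [Fintype ι] (x y : ι → ℂ) :
    ‖x ⬝ᵥ y‖ ^ 2 ≤ (∑ i, ‖x i‖ ^ 2) * ∑ i, ‖y i‖ ^ 2 := by
  have h : ‖x ⬝ᵥ y‖ ≤ ∑ i, ‖x i‖ * ‖y i‖ :=
    (norm_sum_le _ _).trans_eq (by simp only [norm_mul])
  exact (pow_le_pow_left₀ (norm_nonneg _) h 2).trans (Finset.sum_mul_sq_le_sq_mul_sq _ _ _)

theorem sum_norm_sq_smul_vecMulVec_mulVec {ι κ : Type*} [Fintype ι] [Fintype κ]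
    (c : ℂ) (v : ι → ℂ) (x y : κ → ℂ) :
    ∑ i, ‖(c • Matrix.vecMulVec v x).mulVec y i‖ ^ 2 =
      ‖c‖ ^ 2 * ‖x ⬝ᵥ y‖ ^ 2 * ∑ i, ‖v i‖ ^ 2 := by
  rw [Finset.mul_sum]
  refine Finset.sum_congr rfl fun i _ => ?_
  simp only [Matrix.smul_mulVec, Matrix.vecMulVec_mulVec, Pi.smul_apply, smul_eq_mul,
    op_smul_eq_mul, norm_mul]
  ring

theorem norm_sq_star_dotProduct_mulVec_le {ι κ : Type*} [Fintype ι] [Fintype κ]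
    (A : Matrix ι κ ℂ) (u : ι → ℂ) (w : κ → ℂ) :
    ‖star u ⬝ᵥ A.mulVec w‖ ^ 2 ≤
      (∑ j, ‖A.conjTranspose.mulVec u j‖ ^ 2) * ∑ j, ‖w j‖ ^ 2 := by
  have h : star u ⬝ᵥ A.mulVec w = star (A.conjTranspose.mulVec u) ⬝ᵥ w := by
    rw [Matrix.star_mulVec, Matrix.conjTranspose_conjTranspose, Matrix.dotProduct_mulVec]
  rw [h]
  refine (norm_sq_dotProduct_le _ _).trans_eq ?_
  simp only [Pi.star_apply, norm_star]

theorem logb_two_one_add_div_le {a b : ℝ} (ha : 0 ≤ a) (hb : 0 ≤ b) :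
    Real.logb 2 (1 + a / (b + 1)) ≤ a / Real.log 2 := by
  have hq : 0 ≤ a / (b + 1) := by positivity
  refine div_le_div_of_nonneg_right ?_ (Real.log_nonneg one_le_two)
  have hlog := Real.log_le_sub_one_of_pos (show 0 < 1 + a / (b + 1) by positivity)
  have hdiv : a / (b + 1) ≤ a := div_le_self ha (by linarith)
  linarith

theorem rate_upper_bound_chain
    (K Nt Nr NRF N : ℕ) (hK : 0 < K) (hNt : 0 < Nt) (hNr : 0 < Nr)
    (hNRF : 0 < NRF) (hN : 0 < N)
    (ρ ω : ℝ) (hρ : 0 < ρ) (hω : 0 ≤ ω) (τ : ℝ)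
    (n : Fin N)
    (α : Fin K → ℂ) (f : Fin K → ℝ)
    (u : Fin K → (Fin Nt → ℂ)) (v : Fin K → (Fin Nr → ℂ))
    (hv : ∀ k, ∑ i, ‖v k i‖ ^ 2 = 1)
    (A : Fin K → Matrix (Fin Nt) (Fin NRF) ℂ)
    (w : Fin K → Fin N → (Fin NRF → ℂ))
    (hw : ∀ k m, ∑ j, ‖w k m j‖ ^ 2 ≤ ω)
    (H : Fin K → Matrix (Fin Nr) (Fin Nt) ℂ)
    (hH : ∀ k, H k =
      ((Real.sqrt ((Nt : ℝ) * Nr) : ℂ) * α k *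
          Complex.exp (-(2 * π * f k * τ : ℝ) * Complex.I)) •
        Matrix.vecMulVec (v k) (star (u k))) :
    ∑ k, Real.logb 2
        (1 +
          ((ρ / N) * ∑ i, ‖(H k).mulVec ((A k).mulVec (w k n)) i‖ ^ 2) /
            ((∑ n' ∈ Finset.univ.erase n,
                (ρ / N) * ∑ i, ‖(H k).mulVec ((A k).mulVec (w k n')) i‖ ^ 2) + 1))
      ≤ (ρ * ω * Nr * Nt / (N * Real.log 2)) *
          ∑ k, ‖α k‖ ^ 2 * ∑ j, ‖(A k).conjTranspose.mulVec (u k) j‖ ^ 2 := by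
  have hgain : ∀ k, ‖(Real.sqrt ((Nt : ℝ) * Nr) : ℂ) * α k *
      Complex.exp (-(2 * π * f k * τ : ℝ) * Complex.I)‖ ^ 2 = Nt * Nr * ‖α k‖ ^ 2 := by
    intro k
    rw [← Complex.ofReal_neg, norm_mul, norm_mul, Complex.norm_exp_ofReal_mul_I,
      Complex.norm_real, mul_one, mul_pow, Real.norm_eq_abs, sq_abs,
      Real.sq_sqrt (by positivity)]
  have hpower : ∀ k, ∑ i, ‖(H k).mulVec ((A k).mulVec (w k n)) i‖ ^ 2 ≤
      Nt * Nr * ‖α k‖ ^ 2 * ((∑ j, ‖(A k).conjTranspose.mulVec (u k) j‖ ^ 2) * ω) := by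
    intro k
    rw [hH k, sum_norm_sq_smul_vecMulVec_mulVec, hv k, mul_one, hgain k]
    gcongr
    exact (norm_sq_star_dotProduct_mulVec_le _ _ _).trans (by gcongr; exact hw k n)
  rw [Finset.mul_sum]
  refine Finset.sum_le_sum fun k _ => ?_
  refine (logb_two_one_add_div_le (by positivity)
    (Finset.sum_nonneg fun _ _ => by positivity)).trans ?_
  have hlog : 0 < Real.log 2 := Real.log_pos one_lt_two
  calc _ ≤ (ρ / N) * (Nt * Nr * ‖α k‖ ^ 2 *
        ((∑ j, ‖(A k).conjTranspose.mulVec (u k) j‖ ^ 2) * ω)) / Real.log 2 := by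
        gcongr
        exact hpower k
    _ = _ := by
        field_simp
end
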